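/- Let σ be a partition sampled uniformly at random from Π_n, let L(σ) denote the maximum size of a part of σ, and let r = r(n) be the unique positive real root of r·e^r = n. Then for every ε > 0 there exists n₀ such that for all n ≥ n₀ and every real x with e²·r(n) ≤ x ≤ n/2: P(L(σ) ≥ x) ≤ (1 + ε)·e^{−x(ln x − ln r(n) − 2) + ln n}. -/

import Mathlib

open scoped Classical

noncomputable section

/-- the `n`-th Bell number: the number of partitions of `{1,…,n}` -/
def bell (n : ℕ) : ℕ := Nat.card (Finpartition (Finset.univ : Finset (Fin n)))

/-- the maximum size of a part of a partition -/
def maxPart {n : ℕ} (π : Finpartition (Finset.univ : Finset (Fin n))) : ℕ :=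
  π.parts.sup Finset.card

/-- The maps to `Fin j` whose fibres are exactly the parts of `π`. -/
def colorings {α : Type*} [Fintype α] [DecidableEq α]
    (π : Finpartition (Finset.univ : Finset α)) (j : ℕ) : Finset (α → Fin j) :=
  Finset.univ.filter fun f => ∀ a b, b ∈ π.part a ↔ f a = f b

section Colorings

variable {α : Type*} [Fintype α] [DecidableEq α]

lemma mem_colorings {π : Finpartition (Finset.univ : Finset α)} {j : ℕ} {f : α → Fin j} :
    f ∈ colorings π j ↔ ∀ a b, b ∈ π.part a ↔ f a = f b := by
  simp [colorings]

lemma card_colorings (π : Finpartition (Finset.univ : Finset α)) (j : ℕ) :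
    (colorings π j).card = j.descFactorial π.parts.card := by
  have hne : ∀ t : π.parts, ∃ a, a ∈ t.1 := fun t => π.nonempty_of_mem_parts t.2
  choose c hc using hne
  have hpart : ∀ t : π.parts, π.part (c t) = t.1 := fun t => π.part_eq_of_mem t.2 (hc t)
  have e : {f // f ∈ colorings π j} ≃ (π.parts ↪ Fin j) :=
    { toFun := fun f => ⟨fun t => f.1 (c t), fun t u htu => by
        have h := (mem_colorings.1 f.2 (c t) (c u)).2 htu
        rw [hpart] at h
        exact Subtype.ext (π.eq_of_mem_parts t.2 u.2 h (hc u))⟩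
      invFun := fun g => ⟨fun a => g ⟨π.part a, π.part_mem.2 (Finset.mem_univ a)⟩, by
        rw [mem_colorings]
        intro a b
        rw [g.injective.eq_iff, Subtype.mk.injEq,
          π.mem_part_iff_part_eq_part (Finset.mem_univ b) (Finset.mem_univ a), eq_comm]⟩
      left_inv := by
        rintro ⟨f, hf⟩
        refine Subtype.ext (funext fun a => ?_)
        refine ((mem_colorings.1 hf a _).1 ?_).symm
        exact hc ⟨π.part a, _⟩
      right_inv := by
        intro g
        refine DFunLike.ext _ _ fun t => ?_
        exact congrArg g (Subtype.ext (hpart t)) }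
  rw [← Fintype.card_coe, Fintype.card_congr e, Fintype.card_embedding_eq, Fintype.card_coe,
    Fintype.card_fin]

lemma eq_of_mem_colorings {π ρ : Finpartition (Finset.univ : Finset α)} {j : ℕ} {f : α → Fin j}
    (hπ : f ∈ colorings π j) (hρ : f ∈ colorings ρ j) : π = ρ := by
  have key : ∀ a, π.part a = ρ.part a := fun a => by
    ext b
    rw [mem_colorings.1 hπ, mem_colorings.1 hρ]
  ext t
  constructor
  · intro ht
    obtain ⟨a, ha⟩ := π.nonempty_of_mem_parts ht
    rw [← π.part_eq_of_mem ht ha, key]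
    exact ρ.part_mem.2 (Finset.mem_univ a)
  · intro ht
    obtain ⟨a, ha⟩ := ρ.nonempty_of_mem_parts ht
    rw [← ρ.part_eq_of_mem ht ha, ← key]
    exact π.part_mem.2 (Finset.mem_univ a)

lemma exists_mem_colorings {j : ℕ} (f : α → Fin j) :
    ∃ π : Finpartition (Finset.univ : Finset α), f ∈ colorings π j := by
  refine ⟨Finpartition.ofSetoid (Setoid.ker f), mem_colorings.2 fun a b => ?_⟩
  rw [Finpartition.mem_part_ofSetoid_iff_rel, Setoid.ker_def]

lemma pow_card_le_card_finpartition_mul_factorial (k : ℕ) :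
    k ^ Fintype.card α ≤ Nat.card (Finpartition (Finset.univ : Finset α)) * k.factorial := by
  have : Fintype (Finpartition (Finset.univ : Finset α)) := Fintype.ofFinite _
  have hcover : (Finset.univ : Finset (α → Fin k)) ⊆
      (Finset.univ : Finset (Finpartition (Finset.univ : Finset α))).biUnion
        fun π => colorings π k := by
    intro f _
    obtain ⟨π, hπ⟩ := exists_mem_colorings f
    exact Finset.mem_biUnion.2 ⟨π, Finset.mem_univ _, hπ⟩
  calc k ^ Fintype.card α = (Finset.univ : Finset (α → Fin k)).card := by simp
    _ ≤ _ := Finset.card_le_card hcover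
    _ ≤ _ := Finset.card_biUnion_le_card_mul _ _ k.factorial fun π _ => by
        rw [card_colorings]
        rcases le_or_gt π.parts.card k with h | h
        · rw [← Nat.factorial_mul_descFactorial h]
          exact Nat.le_mul_of_pos_left _ (Nat.factorial_pos _)
        · simp [Nat.descFactorial_eq_zero_iff_lt.2 h]
    _ = _ := by rw [Finset.card_univ, Nat.card_eq_fintype_card]

end Colorings

lemma hasSum_descFactorial_div_factorial (p : ℕ) :
    HasSum (fun j : ℕ => (j.descFactorial p : ℝ) / j.factorial) (Real.exp 1) := by
  have h : HasSum (fun i : ℕ => (1 : ℝ) ^ i / i.factorial) (Real.exp 1) := by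
    rw [Real.exp_eq_exp_ℝ]
    exact NormedSpace.expSeries_div_hasSum_exp (1 : ℝ)
  refine ((add_left_injective p).hasSum_iff ?_).1 ?_
  · intro j hj
    have hjp : j < p := by
      by_contra! hle
      exact hj ⟨j - p, Nat.sub_add_cancel hle⟩
    simp [Nat.descFactorial_eq_zero_iff_lt.2 hjp]
  · convert h using 2 with i
    have h1 : i.factorial * (i + p).descFactorial p = (i + p).factorial := by
      simpa using Nat.factorial_mul_descFactorial (Nat.le_add_left p i)
    have h2 : (i.factorial : ℝ) ≠ 0 := by exact_mod_cast i.factorial_ne_zero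
    have h3 : ((i + p).factorial : ℝ) ≠ 0 := by exact_mod_cast (i + p).factorial_ne_zero
    simp only [Function.comp_apply, one_pow]
    rw [div_eq_div_iff h3 h2, one_mul, mul_comm]
    exact_mod_cast h1

section LargePart

variable {α : Type*} [Fintype α] [DecidableEq α]

lemma card_constOn (S : Finset α) {j : ℕ} (v : Fin j) :
    (Finset.univ.filter fun f : α → Fin j => ∀ i ∈ S, f i = v).card
      = j ^ (Fintype.card α - S.card) := by
  have h : (Finset.univ.filter fun f : α → Fin j => ∀ i ∈ S, f i = v)
      = Fintype.piFinset fun i => if i ∈ S then {v} else Finset.univ := by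
    ext f
    simp only [Finset.mem_filter, Finset.mem_univ, true_and, Fintype.mem_piFinset]
    refine forall_congr' fun i => ?_
    by_cases hi : i ∈ S <;> simp [hi]
  rw [h, Fintype.card_piFinset]
  have h2 : ∀ i : α, (if i ∈ S then ({v} : Finset (Fin j)) else Finset.univ).card
      = if i ∈ S then 1 else j := by
    intro i
    split_ifs <;> simp
  simp only [h2]
  rw [Finset.prod_ite, Finset.prod_const_one, one_mul, Finset.prod_const]
  congr 1
  rw [← Finset.card_univ, ← Finset.card_sdiff_of_subset (Finset.subset_univ S)]
  congr 1
  ext i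
  simp

/-- Double counting of the maps to `Fin j` that have a fibre of size at least `k`. -/
lemma sum_descFactorial_le {k : ℕ} (hk : 0 < k)
    (A : Finset (Finpartition (Finset.univ : Finset α)))
    (hA : ∀ π ∈ A, ∃ t ∈ π.parts, k ≤ t.card) (j : ℕ) :
    ∑ π ∈ A, j.descFactorial π.parts.card
      ≤ (Fintype.card α).choose k * j ^ (Fintype.card α - k + 1) := by
  have hdisj : (A : Set (Finpartition (Finset.univ : Finset α))).PairwiseDisjoint
      fun π => colorings π j := by
    intro π _ ρ _ hne
    exact Finset.disjoint_left.2 fun f hf hf' => hne (eq_of_mem_colorings hf hf')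
  have hsub : A.biUnion (fun π => colorings π j) ⊆
      ((Finset.univ : Finset α).powersetCard k ×ˢ (Finset.univ : Finset (Fin j))).biUnion
        fun p => Finset.univ.filter fun f : α → Fin j => ∀ i ∈ p.1, f i = p.2 := by
    intro f hf
    obtain ⟨π, hπ, hf⟩ := Finset.mem_biUnion.1 hf
    obtain ⟨t, ht, hkt⟩ := hA π hπ
    obtain ⟨S, hS, hSk⟩ := Finset.exists_subset_card_eq hkt
    obtain ⟨a, ha⟩ : S.Nonempty := Finset.card_pos.1 (hSk ▸ hk)
    refine Finset.mem_biUnion.2 ⟨(S, f a), ?_, ?_⟩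
    · simp [Finset.mem_powersetCard, hSk]
    · simp only [Finset.mem_filter, Finset.mem_univ, true_and]
      intro i hi
      refine ((mem_colorings.1 hf a i).1 ?_).symm
      rw [π.part_eq_of_mem ht (hS ha)]
      exact hS hi
  calc ∑ π ∈ A, j.descFactorial π.parts.card
      = (A.biUnion fun π => colorings π j).card := by
        rw [Finset.card_biUnion hdisj]
        simp [card_colorings]
    _ ≤ _ := Finset.card_le_card hsub
    _ ≤ _ := Finset.card_biUnion_le_card_mul _ _ (j ^ (Fintype.card α - k)) fun p hp => by
        rw [card_constOn, (Finset.mem_powersetCard.1 (Finset.mem_product.1 hp).1).2]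
    _ = _ := by
        rw [Finset.card_product, Finset.card_powersetCard, Finset.card_univ, Finset.card_univ,
          Fintype.card_fin, mul_assoc, pow_succ']

lemma card_le_of_large_part {k : ℕ} (hk : 0 < k)
    (A : Finset (Finpartition (Finset.univ : Finset α)))
    (hA : ∀ π ∈ A, ∃ t ∈ π.parts, k ≤ t.card) {s : ℝ} (hs : 0 < s) :
    (A.card : ℝ) * Real.exp 1 ≤ (Fintype.card α).choose k *
      ((Fintype.card α - k + 1).factorial / s ^ (Fintype.card α - k + 1)) *
        Real.exp (Real.exp s) := by
  set m := Fintype.card α - k + 1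
  have h1 : HasSum (fun j : ℕ => ∑ π ∈ A, (j.descFactorial π.parts.card : ℝ) / j.factorial)
      (∑ _π ∈ A, Real.exp 1) :=
    hasSum_sum fun π _ => hasSum_descFactorial_div_factorial _
  have h2 : HasSum (fun j : ℕ => (Fintype.card α).choose k * ((m.factorial : ℝ) / s ^ m) *
      (Real.exp s ^ j / j.factorial))
      ((Fintype.card α).choose k * ((m.factorial : ℝ) / s ^ m) * Real.exp (Real.exp s)) := by
    refine HasSum.mul_left _ ?_
    rw [Real.exp_eq_exp_ℝ]
    exact NormedSpace.expSeries_div_hasSum_exp _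
  rw [Finset.sum_const, nsmul_eq_mul] at h1
  refine hasSum_le (fun j => ?_) h1 h2
  rw [← Finset.sum_div, mul_div_assoc']
  refine div_le_div_of_nonneg_right ?_ (by positivity)
  have h3 : (∑ π ∈ A, (j.descFactorial π.parts.card : ℝ))
      ≤ (Fintype.card α).choose k * (j : ℝ) ^ m := by
    exact_mod_cast sum_descFactorial_le hk A hA j
  refine h3.trans ?_
  rw [mul_assoc]
  refine mul_le_mul_of_nonneg_left ?_ (by positivity)
  have h4 := Real.pow_div_factorial_le_exp (x := j * s) (by positivity) m
  rw [div_le_iff₀ (by positivity), mul_pow, Real.exp_nat_mul] at h4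
  rw [div_mul_eq_mul_div, le_div_iff₀ (by positivity)]
  linarith

end LargePart

lemma factorial_le_pow_mul_exp {n : ℕ} (hn : 0 < n) :
    (n.factorial : ℝ) ≤ n * n ^ n * Real.exp (1 - n) := by
  induction n, hn using Nat.le_induction with
  | base => simp
  | succ n hn ih =>
    have hn0 : (0 : ℝ) < n := by exact_mod_cast hn
    have key : Real.exp 1 * (n : ℝ) ^ (n + 1) ≤ ((n : ℝ) + 1) ^ (n + 1) := by
      have h : Real.exp (1 / ((n : ℝ) + 1)) * n ≤ n + 1 := by
        have h1 := Real.add_one_le_exp (-(1 / ((n : ℝ) + 1)))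
        have h2 : -(1 / ((n : ℝ) + 1)) + 1 = n / (n + 1) := by field_simp; ring
        rw [h2, Real.exp_neg] at h1
        have h3 := Real.exp_pos (1 / ((n : ℝ) + 1))
        rw [div_le_iff₀ (by positivity), inv_mul_eq_div, le_div_iff₀ h3] at h1
        linarith
      calc Real.exp 1 * (n : ℝ) ^ (n + 1) = (Real.exp (1 / ((n : ℝ) + 1)) * n) ^ (n + 1) := by
            rw [mul_pow, ← Real.exp_nat_mul]
            congr 2
            push_cast
            field_simp
        _ ≤ _ := pow_le_pow_left₀ (by positivity) h _
    rw [Nat.factorial_succ]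
    push_cast
    have e1 : Real.exp (1 - (n : ℝ)) = Real.exp 1 * Real.exp (1 - ((n : ℝ) + 1)) := by
      rw [← Real.exp_add]; ring_nf
    calc ((n : ℝ) + 1) * n.factorial
        ≤ (n + 1) * (n * n ^ n * Real.exp (1 - n)) := by gcongr
      _ = (n + 1) * (Real.exp 1 * n ^ (n + 1)) * Real.exp (1 - ((n : ℝ) + 1)) := by
          rw [e1]; ring
      _ ≤ _ := by gcongr

lemma factorial_mul_exp_le_bell {n : ℕ} (hn : 3 ≤ n) {r : ℝ} (hr : 1 ≤ r)
    (hrn : r * Real.exp r = n) :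
    (n.factorial : ℝ) * (Real.exp (Real.exp r) / Real.exp 1) ≤ bell n * n ^ 4 * r ^ n := by
  set R := Real.exp r with hR
  have hR0 : 0 < R := Real.exp_pos r
  set K := ⌈R⌉₊ with hK
  have hKR : R ≤ K := Nat.le_ceil R
  have hKR1 : (K : ℝ) < R + 1 := Nat.ceil_lt_add_one hR0.le
  have hRn : R ≤ n := by rw [← hrn]; nlinarith
  have hKn : K ≤ n := Nat.ceil_le.2 hRn
  have hKn' : (K : ℝ) ≤ n := by exact_mod_cast hKn
  have hK0 : 0 < K := Nat.ceil_pos.2 hR0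
  have hn3 : (3 : ℝ) ≤ n := by exact_mod_cast hn
  have hbell : (K : ℝ) ^ n ≤ bell n * K.factorial := by
    have := pow_card_le_card_finpartition_mul_factorial (α := Fin n) K
    rw [Fintype.card_fin] at this
    exact_mod_cast this
  have hmain : (n.factorial : ℝ) * K.factorial * (Real.exp R / Real.exp 1)
      ≤ K ^ n * r ^ n * n ^ 4 := by
    have hKK : (K : ℝ) ^ K ≤ (K / R) ^ n * R ^ K := by
      have h1 : 1 ≤ (K : ℝ) / R := (one_le_div hR0).2 hKR
      calc (K : ℝ) ^ K = (K / R) ^ K * R ^ K := by rw [← mul_pow, div_mul_cancel₀ _ hR0.ne']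
        _ ≤ _ := by gcongr
    have hexp : R ^ K * (Real.exp (1 - n) * Real.exp (1 - K) * (Real.exp R / Real.exp 1))
        ≤ 3 * n := by
      rw [hR, ← Real.exp_nat_mul, ← hR, ← Real.exp_sub, ← Real.exp_add, ← Real.exp_add,
        ← Real.exp_add]
      have h1 : K * r + (1 - n + (1 - K) + (R - 1)) ≤ 1 + r := by
        rw [← hrn]; nlinarith
      calc _ ≤ Real.exp (1 + r) := Real.exp_le_exp.2 h1
        _ = Real.exp 1 * R := by rw [Real.exp_add]
        _ ≤ 3 * n := by
          have := Real.exp_one_lt_d9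
          gcongr
          linarith
    have hKr : (n : ℝ) ^ n * (K / R) ^ n = K ^ n * r ^ n := by
      rw [← mul_pow, ← mul_pow, ← hrn]
      congr 1
      field_simp
    calc (n.factorial : ℝ) * K.factorial * (Real.exp R / Real.exp 1)
        ≤ (n * n ^ n * Real.exp (1 - n)) * (K * K ^ K * Real.exp (1 - K)) *
            (Real.exp R / Real.exp 1) := by
          gcongr
          · exact factorial_le_pow_mul_exp (by omega)
          · exact factorial_le_pow_mul_exp hK0
      _ ≤ (n * n ^ n * Real.exp (1 - n)) * (n * ((K / R) ^ n * R ^ K) * Real.exp (1 - K)) *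
            (Real.exp R / Real.exp 1) := by gcongr
      _ = n ^ 2 * (n ^ n * (K / R) ^ n) *
            (R ^ K * (Real.exp (1 - n) * Real.exp (1 - K) * (Real.exp R / Real.exp 1))) := by
          ring
      _ ≤ n ^ 2 * (n ^ n * (K / R) ^ n) * (3 * n) := by gcongr
      _ ≤ n ^ 2 * (n ^ n * (K / R) ^ n) * (n * n) := by gcongr
      _ = K ^ n * r ^ n * n ^ 4 := by rw [hKr]; ring
  have hKf : (0 : ℝ) < K.factorial := by exact_mod_cast K.factorial_pos
  refine le_of_mul_le_mul_right ?_ hKf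
  have hr0 : 0 ≤ r := by linarith
  calc (n.factorial : ℝ) * (Real.exp R / Real.exp 1) * K.factorial
      = (n.factorial : ℝ) * K.factorial * (Real.exp R / Real.exp 1) := by ring
    _ ≤ K ^ n * r ^ n * n ^ 4 := hmain
    _ ≤ (bell n * K.factorial) * r ^ n * n ^ 4 := by gcongr
    _ = _ := by ring

lemma pow_div_factorial_le_exp_neg {r x : ℝ} {k : ℕ} (hr : 0 < r) (hx : Real.exp 2 * r ≤ x)
    (hxk : x ≤ k) :
    r ^ k / k.factorial ≤ Real.exp (-(x * (Real.log x - Real.log r - 1))) := by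
  have hx0 : 0 < x := lt_of_lt_of_le (by positivity) hx
  have hk0 : (0 : ℝ) < k := hx0.trans_le hxk
  have hlogx : 2 ≤ Real.log x - Real.log r := by
    have := Real.log_le_log (by positivity) hx
    rw [Real.log_mul (Real.exp_pos _).ne' hr.ne', Real.log_exp] at this
    linarith
  have hlogk : Real.log x ≤ Real.log k := Real.log_le_log hx0 hxk
  have h1 : r ^ k / k.factorial ≤ Real.exp (-(k * (Real.log k - Real.log r - 1))) := by
    have h2 := Real.pow_div_factorial_le_exp (x := k) hk0.le k
    have h3 : r ^ k = (k : ℝ) ^ k * Real.exp (-(k * (Real.log k - Real.log r))) := by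
      rw [← Real.exp_log hr, ← Real.exp_nat_mul, Real.log_exp]
      nth_rewrite 2 [← Real.exp_log hk0]
      rw [← Real.exp_nat_mul, ← Real.exp_add]
      ring_nf
    rw [h3, mul_div_right_comm]
    calc _ ≤ Real.exp k * Real.exp (-(k * (Real.log k - Real.log r))) := by gcongr
      _ = _ := by rw [← Real.exp_add]; ring_nf
  refine h1.trans (Real.exp_le_exp.2 (neg_le_neg ?_))
  exact mul_le_mul hxk (by linarith) (by linarith) hk0.le

lemma pow_four_le_exp {n r x : ℝ} (hr : 0 < r) (hrn : r * Real.exp r = n)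
    (hx : Real.exp 2 * r ≤ x) : n ^ 4 ≤ Real.exp x := by
  have he := Real.exp_one_gt_d9
  have h1 : r ≤ Real.exp (r / 2) := by
    have h2 := Real.add_one_le_exp (r / 2 - 1)
    rw [Real.exp_sub, le_div_iff₀ (Real.exp_pos _)] at h2
    nlinarith
  have h6 : 6 * r ≤ x := by
    have : Real.exp 2 = Real.exp 1 * Real.exp 1 := by rw [← Real.exp_add]; norm_num
    have h6 : 6 ≤ Real.exp 2 := by nlinarith
    nlinarith
  calc n ^ 4 = (r * Real.exp r) ^ 4 := by rw [hrn]
    _ ≤ (Real.exp (r / 2) * Real.exp r) ^ 4 := by gcongr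
    _ = Real.exp (6 * r) := by
      rw [← Real.exp_add, ← Real.exp_nat_mul]
      congr 1
      push_cast
      ring
    _ ≤ _ := Real.exp_le_exp.2 h6

lemma card_large_maxPart_le {n k : ℕ} (hn : 3 ≤ n) (hk : 0 < k) (hkn : k ≤ n) {r : ℝ}
    (hr : 1 ≤ r) (hrn : r * Real.exp r = n) :
    (Nat.card {π : Finpartition (Finset.univ : Finset (Fin n)) // k ≤ maxPart π} : ℝ)
      ≤ bell n * (n ^ 4 * n * (r ^ k / k.factorial)) := by
  have hr0 : 0 < r := by linarith
  have : Fintype (Finpartition (Finset.univ : Finset (Fin n))) := Fintype.ofFinite _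
  set A : Finset (Finpartition (Finset.univ : Finset (Fin n))) :=
    Finset.univ.filter fun π => k ≤ maxPart π
  have hcard : Nat.card {π : Finpartition (Finset.univ : Finset (Fin n)) // k ≤ maxPart π}
      = A.card := by
    rw [Nat.card_eq_fintype_card, Fintype.card_subtype]
  have hA : ∀ π ∈ A, ∃ t ∈ π.parts, k ≤ t.card := by
    intro π hπ
    exact (Finset.le_sup_iff hk).1 (Finset.mem_filter.1 hπ).2
  have h1 := card_le_of_large_part hk A hA hr0
  have h2 := factorial_mul_exp_le_bell hn hr hrn
  rw [Fintype.card_fin] at h1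
  rw [hcard]
  have he := Real.exp_pos 1
  rw [← le_div_iff₀ he, mul_div_assoc] at h1
  have hfac : ((n.choose k : ℕ) : ℝ) * (n - k + 1).factorial
      = n.factorial * ((n - k + 1 : ℕ) : ℝ) / k.factorial := by
    rw [eq_div_iff (by exact_mod_cast k.factorial_ne_zero), Nat.factorial_succ]
    have := Nat.choose_mul_factorial_mul_factorial hkn
    rw [← this]
    push_cast
    ring
  have hmn : ((n - k + 1 : ℕ) : ℝ) ≤ n := by exact_mod_cast (by omega : n - k + 1 ≤ n)
  have hpow : r ^ n ≤ r ^ k * r ^ (n - k + 1) := by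
    rw [← pow_add]
    exact pow_le_pow_right₀ hr (by omega)
  calc (A.card : ℝ)
      ≤ n.choose k * (n - k + 1).factorial / r ^ (n - k + 1) *
          (Real.exp (Real.exp r) / Real.exp 1) := h1.trans_eq (by ring)
    _ = ((n - k + 1 : ℕ) : ℝ) / (k.factorial * r ^ (n - k + 1)) *
          (n.factorial * (Real.exp (Real.exp r) / Real.exp 1)) := by
        rw [hfac]
        field_simp
    _ ≤ n / (k.factorial * r ^ (n - k + 1)) * (bell n * n ^ 4 * r ^ n) := by gcongr
    _ ≤ n / (k.factorial * r ^ (n - k + 1)) *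
          (bell n * n ^ 4 * (r ^ k * r ^ (n - k + 1))) := by gcongr
    _ = _ := by field_simp

/-- Tail bound for the maximum part size of a uniformly random partition of `{1,…,n}`:
if `r·e^r = n` then for `e²·r ≤ x ≤ n/2`,
`P(L(σ) ≥ x) ≤ (1+ε)·e^{−x(ln x − ln r − 2) + ln n}`. -/
theorem random_partition_max_part :
    ∀ ε : ℝ, 0 < ε → ∃ n₀ : ℕ, ∀ n : ℕ, n₀ ≤ n → ∀ r : ℝ, 0 < r →
      r * Real.exp r = (n : ℝ) →
      ∀ x : ℝ, Real.exp 2 * r ≤ x → x ≤ (n : ℝ) / 2 →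
      (Nat.card {π : Finpartition (Finset.univ : Finset (Fin n)) //
          x ≤ (maxPart π : ℝ)} : ℝ) / (bell n : ℝ) ≤
        (1 + ε) * Real.exp (-(x * (Real.log x - Real.log r - 2)) + Real.log n) := by
  intro ε hε
  refine ⟨3, fun n hn r hr hrn x hx hxn => ?_⟩
  have hn3 : (3 : ℝ) ≤ n := by exact_mod_cast hn
  have hr1 : 1 ≤ r := by
    by_contra! h
    have h1 : Real.exp r < Real.exp 1 := Real.exp_lt_exp.2 h
    have h2 := Real.exp_one_lt_d9
    have h3 := Real.exp_pos r
    nlinarith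
  have hx0 : 0 < x := lt_of_lt_of_le (by positivity) hx
  have hkn : ⌈x⌉₊ ≤ n := Nat.ceil_le.2 (by linarith)
  have hbell : (0 : ℝ) ≤ bell n := Nat.cast_nonneg _
  refine div_le_of_le_mul₀ hbell (by positivity) ?_
  have h1 := card_large_maxPart_le hn (Nat.ceil_pos.2 hx0) hkn hr1 hrn
  simp only [Nat.ceil_le] at h1
  refine h1.trans ?_
  rw [mul_comm]
  refine mul_le_mul_of_nonneg_right ?_ hbell
  calc (n : ℝ) ^ 4 * n * (r ^ ⌈x⌉₊ / ⌈x⌉₊.factorial)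
      ≤ Real.exp x * Real.exp (Real.log n) *
          Real.exp (-(x * (Real.log x - Real.log r - 1))) := by
        rw [Real.exp_log (by linarith)]
        gcongr
        · exact pow_four_le_exp hr hrn hx
        · exact pow_div_factorial_le_exp_neg hr hx (Nat.le_ceil x)
    _ = Real.exp (-(x * (Real.log x - Real.log r - 2)) + Real.log n) := by
        rw [← Real.exp_add, ← Real.exp_add]
        ring_nf
    _ ≤ _ := le_mul_of_one_le_left (Real.exp_pos _).le (by linarith)
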